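/- arXiv:2605.02314 — 3 statements merged into one kernel-verified Lean document; each statement's English description precedes it below -/
import Mathlib

section
/- A symbolic matrix product P (of degree k ≥ 1, with ℓ variables) is real-eigenvalued if and only if P is symmetric. That is: for every n ≥ 1 and every assignment of real n×n matrices to the variables, all complex eigenvalues of the evaluated product are real, if and only if k is even and some cyclic shift of the word P can be written as L·Lᵀ. -/
open Matrix

/-- Evaluation of the symbolic matrix product `P = X_{ι 0}^{τ 0} ⋯ X_{ι (k-1)}^{τ (k-1)}`
on an assignment `A` of real `n × n` matrices; exponent `false` is the matrix itself,
`true` its transpose. -/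
noncomputable def evalWord {k ℓ n : ℕ} (ι : Fin k → Fin ℓ) (τ : Fin k → Bool)
    (A : Fin ℓ → Matrix (Fin n) (Fin n) ℝ) : Matrix (Fin n) (Fin n) ℝ :=
  ((List.finRange k).map (fun i => if τ i then (A (ι i))ᵀ else A (ι i))).prod

/-- `P` is real-eigenvalued: for every `n ≥ 1` and every assignment, every complex
eigenvalue (root of the characteristic polynomial, mapped into `ℂ`) is real. -/
def RealEigenvalued {k ℓ : ℕ} (ι : Fin k → Fin ℓ) (τ : Fin k → Bool) : Prop :=
  ∀ n : ℕ, 1 ≤ n → ∀ A : Fin ℓ → Matrix (Fin n) (Fin n) ℝ, ∀ μ : ℂ,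
    (Polynomial.map (algebraMap ℝ ℂ) (Matrix.charpoly (evalWord ι τ A))).IsRoot μ →
    μ.im = 0

/-- `P` is symmetric: `k` is even and some cyclic shift of the word can
be written as `L·Lᵀ`. -/
def SymmetricWord {k ℓ : ℕ} (hk : 0 < k) (ι : Fin k → Fin ℓ) (τ : Fin k → Bool) : Prop :=
  k % 2 = 0 ∧ ∃ j : ℕ, j < k ∧ ∀ s : ℕ, s < k / 2 →
    ι ⟨(j + 1 + s) % k, Nat.mod_lt _ hk⟩ = ι ⟨(j + k - s) % k, Nat.mod_lt _ hk⟩ ∧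
    τ ⟨(j + 1 + s) % k, Nat.mod_lt _ hk⟩ ≠ τ ⟨(j + k - s) % k, Nat.mod_lt _ hk⟩

open Polynomial in
theorem Matrix.IsHermitian.im_eq_zero_of_isRoot_charpoly {n : Type*} [Fintype n] [DecidableEq n]
    {M : Matrix n n ℝ} (hM : M.IsHermitian) {μ : ℂ}
    (hμ : (M.charpoly.map (algebraMap ℝ ℂ)).IsRoot μ) : μ.im = 0 := by
  rw [hM.charpoly_eq, Polynomial.map_prod, Polynomial.IsRoot.def, eval_prod,
    Finset.prod_eq_zero_iff] at hμ
  obtain ⟨i, -, hi⟩ := hμ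
  rw [Polynomial.map_sub, map_X, map_C, eval_sub, eval_X, eval_C, sub_eq_zero] at hi
  simp [hi]

theorem Matrix.charpoly_list_prod_rotate {R n : Type*} [CommRing R] [Fintype n] [DecidableEq n]
    (l : List (Matrix n n R)) (m : ℕ) : (l.rotate m).prod.charpoly = l.prod.charpoly := by
  rw [List.rotate_eq_drop_append_take_mod, List.prod_append, charpoly_mul_comm,
    List.prod_take_mul_prod_drop]

/-- A word of even length that reads as its own transpose evaluates to `B * Bᵀ`. -/
theorem Matrix.list_prod_eq_mul_transpose {R n : Type*} [CommSemiring R] [Fintype n]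
    [DecidableEq n] (l : List (Matrix n n R)) {m : ℕ} (hl : l.length = 2 * m)
    (h : ∀ s (hs : s < m), l[2 * m - 1 - s] = (l[s])ᵀ) :
    l.prod = (l.take m).prod * ((l.take m).prod)ᵀ := by
  rw [transpose_list_prod, ← List.prod_take_mul_prod_drop l m]
  congr 2
  refine List.ext_getElem (by simp; omega) fun i h₁ h₂ => ?_
  simp only [List.length_drop] at h₁
  have := h (m - 1 - i) (by omega)
  simp only [List.getElem_drop, List.getElem_reverse, List.getElem_map, List.length_map,
    List.length_take, List.getElem_take]
  convert this using 3 <;> omega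

theorem SymmetricWord.realEigenvalued {k ℓ : ℕ} {hk : 0 < k} {ι : Fin k → Fin ℓ}
    {τ : Fin k → Bool} (h : SymmetricWord hk ι τ) : RealEigenvalued ι τ := by
  obtain ⟨hpar, j, hj, hsym⟩ := h
  intro n _ A μ hμ
  set f : Fin k → Matrix (Fin n) (Fin n) ℝ := fun i => if τ i then (A (ι i))ᵀ else A (ι i) with hf
  rw [evalWord, ← charpoly_list_prod_rotate _ (j + 1),
    list_prod_eq_mul_transpose (m := k / 2) _ (by simp; omega)] at hμ
  · exact IsHermitian.im_eq_zero_of_isRoot_charpoly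
      (by rw [← conjTranspose_eq_transpose_of_trivial]; exact isHermitian_mul_conjTranspose_self _)
      hμ
  intro s hs
  obtain ⟨hι, hτ⟩ := hsym s hs
  simp only [List.getElem_rotate, List.getElem_map, List.getElem_finRange, List.length_map,
    List.length_finRange, Fin.cast_mk]
  have e₁ : 2 * (k / 2) - 1 - s + (j + 1) = j + k - s := by omega
  have e₂ : s + (j + 1) = j + 1 + s := by omega
  simp only [e₁, e₂, hι]
  cases h₁ : τ ⟨(j + 1 + s) % k, Nat.mod_lt _ hk⟩ <;>
    cases h₂ : τ ⟨(j + k - s) % k, Nat.mod_lt _ hk⟩ <;> simp_all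

/-- A complex matrix as a real matrix of twice the size. -/
def Matrix.realify {V : Type*} [Fintype V] [DecidableEq V] :
    Matrix V V ℂ →* Matrix (V ⊕ V) (V ⊕ V) ℝ where
  toFun M := fromBlocks (M.map Complex.re) (-M.map Complex.im) (M.map Complex.im)
    (M.map Complex.re)
  map_one' := by
    have hre : (1 : Matrix V V ℂ).map Complex.re = 1 :=
      Matrix.map_one _ Complex.zero_re Complex.one_re
    have him : (1 : Matrix V V ℂ).map Complex.im = 0 := by
      ext i j; by_cases h : i = j <;> simp [h]
    simp [hre, him]
  map_mul' M N := by
    have hre : (M * N).map Complex.re =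
        M.map Complex.re * N.map Complex.re - M.map Complex.im * N.map Complex.im := by
      ext i j; simp [mul_apply, Finset.sum_sub_distrib]
    have him : (M * N).map Complex.im =
        M.map Complex.re * N.map Complex.im + M.map Complex.im * N.map Complex.re := by
      ext i j; simp [mul_apply, Finset.sum_add_distrib]
    simp only [fromBlocks_multiply, hre, him]
    congr 1
    · rw [neg_mul, sub_eq_add_neg]
    · rw [mul_neg, neg_mul, neg_add]
    · exact add_comm _ _
    · rw [mul_neg, neg_add_eq_sub]

theorem Matrix.realify_conjTranspose {V : Type*} [Fintype V] [DecidableEq V]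
    (M : Matrix V V ℂ) : realify Mᴴ = (realify M)ᵀ := by
  ext (i | i) (j | j) <;> simp [realify]

theorem Matrix.isRoot_charpoly_iff_exists_mulVec {K V : Type*} [Field K] [Fintype V]
    [DecidableEq V] {M : Matrix V V K} {μ : K} :
    M.charpoly.IsRoot μ ↔ ∃ v ≠ 0, M *ᵥ v = μ • v := by
  rw [Polynomial.IsRoot.def, eval_charpoly, ← exists_mulVec_eq_zero_iff]
  simp only [sub_mulVec, sub_eq_zero, scalar_apply, ← smul_one_eq_diagonal, smul_mulVec,
    one_mulVec, eq_comm]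

theorem Matrix.isRoot_charpoly_realify {V : Type*} [Fintype V] [DecidableEq V]
    {M : Matrix V V ℂ} {μ : ℂ} (hμ : M.charpoly.IsRoot μ) :
    ((realify M).charpoly.map (algebraMap ℝ ℂ)).IsRoot μ := by
  rw [isRoot_charpoly_iff_exists_mulVec] at hμ
  obtain ⟨v, hv, hMv⟩ := hμ
  rw [← charpoly_map, isRoot_charpoly_iff_exists_mulVec]
  refine ⟨Sum.elim v (-Complex.I • v), fun h => hv ?_, ?_⟩
  · funext i
    exact congrFun h (Sum.inl i)
  have hM (i j : V) : ((M i j).re : ℂ) = M i j - (M i j).im * Complex.I :=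
    eq_sub_of_add_eq (Complex.re_add_im _)
  funext i
  rcases i with i | i <;> have hi := congrFun hMv i <;>
    simp only [mulVec, dotProduct, Pi.smul_apply, smul_eq_mul] at hi <;>
    simp only [mulVec, dotProduct, Fintype.sum_sum_type, realify, MonoidHom.coe_mk, OneHom.coe_mk,
      map_apply, fromBlocks_apply₁₁, fromBlocks_apply₁₂, fromBlocks_apply₂₁, fromBlocks_apply₂₂,
      Sum.elim_inl, Sum.elim_inr, Pi.smul_apply, smul_eq_mul, neg_apply,
      Complex.coe_algebraMap, Complex.ofReal_neg, ← Finset.sum_add_distrib]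
  · rw [← hi]
    refine Finset.sum_congr rfl fun j _ => ?_
    rw [hM]
    ring
  · rw [mul_left_comm, ← hi, Finset.mul_sum]
    refine Finset.sum_congr rfl fun j _ => ?_
    rw [hM]
    linear_combination (M i j).im * v j * Complex.I_sq

theorem Matrix.trace_im_eq_zero_of_forall_isRoot {V : Type*} [Fintype V] [DecidableEq V]
    {M : Matrix V V ℂ} (h : ∀ μ, M.charpoly.IsRoot μ → μ.im = 0) : M.trace.im = 0 := by
  rw [trace_eq_sum_roots_charpoly, ← Complex.imLm_coe, map_multiset_sum]
  refine Multiset.sum_eq_zero fun x hx => ?_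
  obtain ⟨μ, hμ, rfl⟩ := Multiset.mem_map.1 hx
  exact h μ (Polynomial.isRoot_of_mem_roots hμ)

/-- The trace of a real-eigenvalued word is real on complex matrices as well, with the transpose
replaced by the conjugate transpose. -/
theorem RealEigenvalued.trace_im_eq_zero {k ℓ : ℕ} {ι : Fin k → Fin ℓ} {τ : Fin k → Bool}
    (h : RealEigenvalued ι τ) {V : Type*} [Fintype V] [DecidableEq V] [Nonempty V]
    (A : Fin ℓ → Matrix V V ℂ) :
    ((List.finRange k).map fun i => if τ i then (A (ι i))ᴴ else A (ι i)).prod.trace.im = 0 := by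
  refine trace_im_eq_zero_of_forall_isRoot fun μ hμ => ?_
  let e := Fintype.equivFin (V ⊕ V)
  refine h _ Fintype.card_pos (fun a => reindexAlgEquiv ℝ ℝ e (realify (A a))) μ ?_
  convert isRoot_charpoly_realify hμ using 2
  rw [← charpoly_reindex e, ← coe_reindexAlgEquiv ℝ ℝ, map_list_prod, map_list_prod, evalWord,
    List.map_map, List.map_map]
  congr 3
  funext i
  cases hτ : τ i <;> simp [hτ, realify_conjTranspose]

/-- The edges labelled `x` of the directed cycle on `Fin k` whose edge from `u` to `u + 1` is
labelled `w u`. -/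
def cycleMatrix {k : ℕ} [NeZero k] {α : Type*} [DecidableEq α] (R : Type*) [Zero R] [One R]
    (w : Fin k → α) (x : α) : Matrix (Fin k) (Fin k) R :=
  of fun u v => if v = u + 1 ∧ w u = x then 1 else 0

section cycleMatrix

variable {k : ℕ} [NeZero k] {α : Type*} [DecidableEq α]

theorem prod_map_cycleMatrix_apply {R : Type*} [Semiring R] (w : Fin k → α) (l : List α)
    (u v : Fin k) : (l.map (cycleMatrix R w)).prod u v =
      if v = u + Fin.ofNat k l.length ∧
        ∀ i (hi : i < l.length), w (u + Fin.ofNat k i) = l[i] then 1 else 0 := by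
  induction l generalizing u with
  | nil => simp [one_apply, eq_comm]
  | cons x l ih =>
    have hsucc (i : ℕ) : u + Fin.ofNat k (i + 1) = u + 1 + Fin.ofNat k i := by
      ext; simp [Fin.val_add, add_assoc, add_comm 1]
    rw [List.map_cons, List.prod_cons, mul_apply, Finset.sum_eq_single (u + 1)]
    · rw [ih, cycleMatrix, of_apply, ite_zero_mul_ite_zero, mul_one]
      refine if_congr ?_ rfl rfl
      constructor
      · rintro ⟨⟨-, hx⟩, hv, hl⟩
        refine ⟨hv.trans (hsucc _).symm, ?_⟩
        rintro (_ | i) hi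
        · simpa using hx
        · rw [hsucc]
          exact hl i (Nat.lt_of_succ_lt_succ hi)
      · rintro ⟨hv, hl⟩
        refine ⟨⟨rfl, by simpa using hl 0 (Nat.succ_pos _)⟩, hv.trans (hsucc _), fun i hi => ?_⟩
        rw [← hsucc]
        exact hl (i + 1) (Nat.succ_lt_succ hi)
    · intro b _ hb
      simp [cycleMatrix, hb]
    · simp

theorem trace_prod_map_cycleMatrix (R : Type*) [Semiring R] (w : Fin k → α) (l : List α)
    (hl : l.length = k) : (l.map (cycleMatrix R w)).prod.trace =
      (Finset.univ.filter fun u : Fin k => ∀ i (hi : i < l.length),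
        w (u + Fin.ofNat k i) = l[i]).card := by
  have h0 : Fin.ofNat k k = 0 := by ext; simp
  simp only [trace, diag_apply, prod_map_cycleMatrix_apply, hl, h0, add_zero, true_and,
    Finset.sum_boole]

end cycleMatrix

open Polynomial in
theorem trace_prod_eq_of_forall_circle {V β : Type*} [Fintype V] [DecidableEq V] (l : List β)
    (F G : β → Matrix V V ℂ)
    (h : ∀ z : ℂ, ‖z‖ = 1 → (l.map fun x => z • F x + G x).prod.trace =
      (l.map fun x => F x + z • G x).prod.trace) :
    (l.map G).prod.trace = (l.map F).prod.trace := by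
  let p (F G : β → Matrix V V ℂ) : ℂ[X] :=
    (l.map fun x => (X : ℂ[X]) • (F x).map C + (G x).map C).prod.trace
  have hp (F G) (z : ℂ) : (p F G).eval z = (l.map fun x => z • F x + G x).prod.trace := by
    rw [← coe_evalRingHom, AddMonoidHom.map_trace, ← RingHom.mapMatrix_apply, map_list_prod,
      List.map_map]
    congr 3
    funext x
    ext i j
    simp [mul_comm z]
  have hpq : p F G = p G F := by
    refine eq_of_infinite_eval_eq _ _ (Set.Infinite.mono (s := Metric.sphere 0 1) ?_ ?_)
    · intro z hz
      refine (hp F G z).trans ((h z (mem_sphere_zero_iff_norm.1 hz)).trans ?_)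
      rw [hp]
      congr 3
      funext x
      exact add_comm _ _
    · have hrank : 1 < Module.rank ℝ ℂ := by rw [Complex.rank_real_complex]; norm_num
      refine (isPreconnected_sphere hrank 0 1).infinite_of_nontrivial
        ⟨1, by simp, -1, by simp, fun h => ?_⟩
      have := congrArg Complex.re h
      norm_num at this
  simpa [hp] using congrArg (eval 0) hpq

open ComplexConjugate in
theorem RealEigenvalued.exists_reflection {k ℓ : ℕ} [NeZero k] {ι : Fin k → Fin ℓ}
    {τ : Fin k → Bool} (h : RealEigenvalued ι τ) :
    ∃ u : Fin k, ∀ i : Fin k, ι (u + i) = ι i.rev ∧ τ (u + i) = !τ i.rev := by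
  let w (i : Fin k) : Fin ℓ × Bool := (ι i, τ i)
  let w' (i : Fin k) : Fin ℓ × Bool := (ι i, !τ i)
  let F (i : Fin k) := cycleMatrix ℂ w (w i)
  let G (i : Fin k) := (cycleMatrix ℂ w (w' i))ᵀ
  have key : ((List.finRange k).map G).prod.trace = ((List.finRange k).map F).prod.trace := by
    refine trace_prod_eq_of_forall_circle _ _ _ fun z hz => ?_
    obtain ⟨ω, rfl⟩ := IsAlgClosed.exists_pow_nat_eq z two_pos
    have hω : ω * conj ω = 1 := by
      rw [norm_pow, pow_eq_one_iff_of_nonneg (norm_nonneg _) two_ne_zero] at hz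
      rw [Complex.mul_conj', hz]
      norm_num
    have htr := h.trace_im_eq_zero fun a =>
      ω • cycleMatrix ℂ w (a, false) + conj ω • (cycleMatrix ℂ w (a, true))ᵀ
    have hfac (i : Fin k) : (if τ i then (ω • cycleMatrix ℂ w (ι i, false) +
        conj ω • (cycleMatrix ℂ w (ι i, true))ᵀ)ᴴ else ω • cycleMatrix ℂ w (ι i, false) +
        conj ω • (cycleMatrix ℂ w (ι i, true))ᵀ) = ω • F i + conj ω • G i := by
      cases hτ : τ i
      · simp [F, G, w, w', hτ]
      · ext u v
        simp [F, G, w, w', hτ, cycleMatrix, apply_ite conj, add_comm]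
    simp only [hfac] at htr
    have hconj := congrArg Matrix.trace (map_list_prod (starRingEnd ℂ).mapMatrix
      ((List.finRange k).map fun i => ω • F i + conj ω • G i))
    rw [List.map_map, RingHom.mapMatrix_apply, ← AddMonoidHom.map_trace,
      Complex.conj_eq_iff_im.2 htr] at hconj
    have h₁ : (fun i => ω ^ 2 • F i + G i) = fun i => ω • (ω • F i + conj ω • G i) := by
      funext i
      rw [smul_add, smul_smul, smul_smul, hω, one_smul, sq]
    have h₂ : (fun i => F i + ω ^ 2 • G i) = fun i => ω • (conj ω • F i + ω • G i) := by
      funext i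
      rw [smul_add, smul_smul, smul_smul, hω, one_smul, sq]
    have h₃ : (starRingEnd ℂ).mapMatrix ∘ (fun i => ω • F i + conj ω • G i) =
        fun i => conj ω • F i + ω • G i := by
      funext i
      ext u v
      simp [F, G, cycleMatrix, apply_ite conj]
    have h₄ (f : Fin k → Matrix (Fin k) (Fin k) ℂ) :
        ((List.finRange k).map fun i => ω • f i).prod.trace =
          ω ^ k • ((List.finRange k).map f).prod.trace := by
      have := List.smul_prod ((List.finRange k).map f) ω
      rw [List.map_map, List.length_map, List.length_finRange] at this
      rw [← trace_smul, this]
      rfl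
    rw [h₁, h₂, h₄, h₄, hconj, h₃]
  have hF : ((List.finRange k).map F).prod.trace ≠ 0 := by
    have := trace_prod_map_cycleMatrix ℂ w ((List.finRange k).map w) (by simp)
    rw [List.map_map] at this
    rw [show F = cycleMatrix ℂ w ∘ w from rfl, this, Nat.cast_ne_zero, ← Nat.pos_iff_ne_zero,
      Finset.card_pos]
    refine ⟨0, Finset.mem_filter.2 ⟨Finset.mem_univ _, fun i hi => ?_⟩⟩
    simp only [List.length_map, List.length_finRange] at hi
    simp [Fin.ofNat, Nat.mod_eq_of_lt hi]
  have hG : ((List.finRange k).map G).prod =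
      ((((List.finRange k).map w').reverse.map (cycleMatrix ℂ w)).prod)ᵀ := by
    rw [transpose_list_prod, List.map_map, List.map_reverse, List.reverse_reverse, List.map_map]
    rfl
  rw [← key, hG, trace_transpose, trace_prod_map_cycleMatrix ℂ w _ (by simp), Nat.cast_ne_zero,
    ← Nat.pos_iff_ne_zero, Finset.card_pos] at hF
  obtain ⟨u, hu⟩ := hF
  refine ⟨u, fun i => ?_⟩
  have := (Finset.mem_filter.1 hu).2 i (by simp)
  simpa [w, w', Fin.rev, Nat.sub_sub, add_comm] using this

theorem symmetricWord_of_reflection {k ℓ : ℕ} (hk : 0 < k) [NeZero k] {ι : Fin k → Fin ℓ}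
    {τ : Fin k → Bool} (u : Fin k)
    (h : ∀ i : Fin k, ι (u + i) = ι i.rev ∧ τ (u + i) = !τ i.rev) : SymmetricWord hk ι τ := by
  have key (a b : Fin k) (hab : (a + b + 1 : ℕ) % k = u) : ι a = ι b ∧ τ a = !τ b := by
    have hi : u + b.rev = a := by
      ext
      rw [Fin.val_add, ← hab, Fin.val_rev, Nat.mod_add_mod,
        show (a + b + 1 + (k - (b + 1)) : ℕ) = a + k by omega, Nat.add_mod_right,
        Nat.mod_eq_of_lt a.2]
    simpa [hi] using h b.rev
  have hne (a : ℕ) (ha : a < k) : (2 * a + 1) % k ≠ u := fun e => by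
    have := (key ⟨a, ha⟩ ⟨a, ha⟩ (by rw [← e, two_mul])).2
    simp at this
  have hu := u.2
  have hu2 : (u : ℕ) % 2 = 0 := by
    by_contra
    exact hne (u / 2) (by omega)
      (by rw [show 2 * (u / 2 : ℕ) + 1 = u by omega, Nat.mod_eq_of_lt hu])
  have hk2 : k % 2 = 0 := by
    by_contra
    exact hne ((u + k) / 2) (by omega)
      (by rw [show 2 * ((u + k) / 2 : ℕ) + 1 = u + k by omega, Nat.add_mod_right,
        Nat.mod_eq_of_lt hu])
  refine ⟨hk2, (u / 2 + k - 1) % k, Nat.mod_lt _ hk, fun s hs => ?_⟩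
  have hj : (2 * ((u / 2 + k - 1) % k) + 2) % k = u := by
    rcases Nat.eq_zero_or_pos (u : ℕ) with h0 | h0
    · rw [h0, Nat.zero_div, zero_add, Nat.mod_eq_of_lt (a := k - 1) (by omega),
        show 2 * (k - 1) + 2 = k * 2 by omega, Nat.mul_mod_right]
    · rw [show (u / 2 + k - 1 : ℕ) = u / 2 - 1 + k by omega, Nat.add_mod_right,
        Nat.mod_eq_of_lt (a := (u / 2 - 1 : ℕ)) (by omega),
        show 2 * (u / 2 - 1 : ℕ) + 2 = u by omega, Nat.mod_eq_of_lt hu]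
  generalize (u / 2 + k - 1 : ℕ) % k = j at hj ⊢
  obtain ⟨hι, hτ⟩ := key ⟨(j + 1 + s) % k, Nat.mod_lt _ hk⟩ ⟨(j + k - s) % k, Nat.mod_lt _ hk⟩ (by
    rw [← hj, ← Nat.add_mod_right (2 * j + 2) k, show 2 * j + 2 + k = j + 1 + s + (j + k - s) + 1 by omega]
    exact ((Nat.mod_modEq _ _).add (Nat.mod_modEq _ _)).add_right 1)
  exact ⟨hι, by simp [hτ]⟩

/-- A symbolic matrix product is real-eigenvalued if and only if it is symmetric. -/
theorem realEigenvalued_iff_symmetric {k ℓ : ℕ} (hk : 0 < k)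
    (ι : Fin k → Fin ℓ) (τ : Fin k → Bool) :
    RealEigenvalued ι τ ↔ SymmetricWord hk ι τ := by
  have : NeZero k := ⟨hk.ne'⟩
  refine ⟨fun h => ?_, SymmetricWord.realEigenvalued⟩
  obtain ⟨u, hu⟩ := h.exists_reflection
  exact symmetricWord_of_reflection hk u hu
end

section
/- A symbolic complex matrix product P (of degree k ≥ 1, with ℓ variables, whose factors are variables or their Hermitian adjoints) is real-eigenvalued if and only if P is self-adjoint. That is: for every n ≥ 1 and every assignment of complex n×n matrices to the variables, all eigenvalues of the evaluated product are real, if and only if k is even and some cyclic shift of the word P can be written as L·L*. -/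
open Matrix

/-- Evaluation of the symbolic complex matrix product
`P = X_{ι 0}^{τ 0} ⋯ X_{ι (k-1)}^{τ (k-1)}` on an assignment `A` of complex `n × n`
matrices; exponent `false` is the matrix itself, `true` its Hermitian adjoint
(conjugate transpose). -/
noncomputable def evalWordC {k ℓ n : ℕ} (ι : Fin k → Fin ℓ) (τ : Fin k → Bool)
    (A : Fin ℓ → Matrix (Fin n) (Fin n) ℂ) : Matrix (Fin n) (Fin n) ℂ :=
  ((List.finRange k).map (fun i => if τ i then (A (ι i))ᴴ else A (ι i))).prod

/-- `P` is real-eigenvalued: for every `n ≥ 1` and every assignment, every root in `ℂ`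
of the characteristic polynomial of the evaluated product is real. -/
def RealEigenvaluedC {k ℓ : ℕ} (ι : Fin k → Fin ℓ) (τ : Fin k → Bool) : Prop :=
  ∀ n : ℕ, 1 ≤ n → ∀ A : Fin ℓ → Matrix (Fin n) (Fin n) ℂ, ∀ μ : ℂ,
    (Matrix.charpoly (evalWordC ι τ A)).IsRoot μ → μ.im = 0

/-- `P` is self-adjoint: `k` is even and some cyclic shift of the word can
be written as `L·L*`, where `L*` is the reversal of `L` with every exponent flipped. -/
def SelfAdjointWord {k ℓ : ℕ} (hk : 0 < k) (ι : Fin k → Fin ℓ) (τ : Fin k → Bool) : Prop :=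
  k % 2 = 0 ∧ ∃ j : ℕ, j < k ∧ ∀ s : ℕ, s < k / 2 →
    ι ⟨(j + 1 + s) % k, Nat.mod_lt _ hk⟩ = ι ⟨(j + k - s) % k, Nat.mod_lt _ hk⟩ ∧
    τ ⟨(j + 1 + s) % k, Nat.mod_lt _ hk⟩ ≠ τ ⟨(j + k - s) % k, Nat.mod_lt _ hk⟩

namespace RealEigenvaluedWord

open Polynomial

/-- The matrix of the letter at the cyclic position `s` of the word. -/
noncomputable def letter {k ℓ n : ℕ} (hk : 0 < k) (ι : Fin k → Fin ℓ) (τ : Fin k → Bool)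
    (A : Fin ℓ → Matrix (Fin n) (Fin n) ℂ) (s : ℕ) : Matrix (Fin n) (Fin n) ℂ :=
  if τ ⟨s % k, Nat.mod_lt _ hk⟩ then (A (ι ⟨s % k, Nat.mod_lt _ hk⟩))ᴴ
  else A (ι ⟨s % k, Nat.mod_lt _ hk⟩)

theorem evalWordC_eq_prod_letter {k ℓ n : ℕ} (hk : 0 < k) (ι : Fin k → Fin ℓ) (τ : Fin k → Bool)
    (A : Fin ℓ → Matrix (Fin n) (Fin n) ℂ) :
    evalWordC ι τ A = ((List.range k).map (letter hk ι τ A)).prod := by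
  rw [← List.map_coe_finRange_eq_range, List.map_map]
  unfold evalWordC
  congr 2
  funext i
  simp [letter, Nat.mod_eq_of_lt i.isLt]

/-! ### Self-adjoint words have real eigenvalues -/

theorem charpoly_prod_shift {n k : ℕ} (hk : 0 < k) (g : ℕ → Matrix (Fin n) (Fin n) ℂ)
    (hg : ∀ s, g (s + k) = g s) (a : ℕ) :
    ((List.range k).map fun s => g (a + s)).prod.charpoly =
      ((List.range k).map g).prod.charpoly := by
  induction a with
  | zero => simp
  | succ a ih =>
    rw [← ih]
    obtain ⟨m, rfl⟩ : ∃ m, k = m + 1 := ⟨k - 1, by omega⟩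
    rw [List.prod_range_succ, List.prod_range_succ', Matrix.charpoly_mul_comm]
    have h : g (a + 1 + m) = g (a + 0) := by rw [add_zero, ← hg a]; congr 1; ring
    have h' : (fun s => g (a + 1 + s)) = fun s => g (a + (s + 1)) := by
      funext s; congr 1; ring
    rw [h, h']

theorem prod_range_eq_conjTranspose {n : ℕ} (h : ℕ) (f g : ℕ → Matrix (Fin n) (Fin n) ℂ)
    (hfg : ∀ s < h, g (h - 1 - s) = (f s)ᴴ) :
    ((List.range h).map g).prod = (((List.range h).map f).prod)ᴴ := by
  induction h generalizing g with
  | zero => simp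
  | succ h ih =>
    rw [List.prod_range_succ f, List.prod_range_succ' g, Matrix.conjTranspose_mul,
      ← ih fun s => g (s + 1)]
    · congr 1
      simpa using hfg h (by omega)
    · intro s hs
      rw [← hfg s (by omega)]
      congr 1
      omega

theorem im_eq_zero_of_isRoot_charpoly {n : ℕ} {M : Matrix (Fin n) (Fin n) ℂ}
    (hM : M.IsHermitian) {μ : ℂ} (hμ : M.charpoly.IsRoot μ) : μ.im = 0 := by
  have h : μ ∈ M.charpoly.roots :=
    (mem_roots (Matrix.charpoly_monic M).ne_zero).2 hμ
  rw [hM.roots_charpoly_eq_eigenvalues] at h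
  obtain ⟨i, -, rfl⟩ := Multiset.mem_map.1 h
  simp

theorem realEigenvaluedC_of_selfAdjointWord {k ℓ : ℕ} (hk : 0 < k) (ι : Fin k → Fin ℓ)
    (τ : Fin k → Bool) (hP : SelfAdjointWord hk ι τ) : RealEigenvaluedC ι τ := by
  obtain ⟨heven, j, -, hj⟩ := hP
  intro n _ A μ hμ
  obtain ⟨h, rfl⟩ : ∃ h, k = h + h := ⟨k / 2, by omega⟩
  rw [evalWordC_eq_prod_letter hk, ← charpoly_prod_shift hk _ _ (j + 1)] at hμ
  · refine im_eq_zero_of_isRoot_charpoly ?_ hμ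
    rw [List.range_add, List.map_append, List.prod_append, List.map_map,
      prod_range_eq_conjTranspose h (fun s => letter hk ι τ A (j + 1 + s))
        ((fun s => letter hk ι τ A (j + 1 + s)) ∘ (h + ·))]
    · exact Matrix.isHermitian_mul_conjTranspose_self _
    · intro s hs
      obtain ⟨h₁, h₂⟩ := hj s (by omega)
      have e : j + 1 + (h + (h - 1 - s)) = j + (h + h) - s := by omega
      simp only [Function.comp_apply, letter, e, ← h₁]
      cases h₃ : τ ⟨(j + (h + h) - s) % (h + h), Nat.mod_lt _ hk⟩ <;> simp_all
  · intro s
    simp [letter]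

/-! ### Closed walks on a cycle -/

theorem prod_range_apply_ne_zero {m : ℕ} {n : Type*} [Fintype n] [DecidableEq n]
    (M : ℕ → Matrix n n ℕ) (v : ℕ → n) (h : ∀ s < m, M s (v s) (v (s + 1)) ≠ 0) :
    ((List.range m).map M).prod (v 0) (v m) ≠ 0 := by
  induction m with
  | zero => simp
  | succ m ih =>
    rw [List.prod_range_succ, Matrix.mul_apply]
    intro h0
    have := Finset.sum_eq_zero_iff.1 h0 (v m) (Finset.mem_univ _)
    exact mul_ne_zero (ih fun s hs => h s (by omega)) (h m (by omega)) this

theorem exists_walk_of_prod_range_apply_ne_zero {m : ℕ} {n : Type*} [Fintype n] [DecidableEq n]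
    (M : ℕ → Matrix n n ℕ) (p q : n) (h : ((List.range m).map M).prod p q ≠ 0) :
    ∃ v : ℕ → n, v 0 = p ∧ v m = q ∧ ∀ s < m, M s (v s) (v (s + 1)) ≠ 0 := by
  induction m generalizing q with
  | zero =>
    refine ⟨fun _ => p, rfl, ?_, by simp⟩
    by_contra hne
    exact h (by simp [Matrix.one_apply_ne hne])
  | succ m ih =>
    rw [List.prod_range_succ, Matrix.mul_apply] at h
    obtain ⟨r, -, hr⟩ := Finset.exists_ne_zero_of_sum_ne_zero h
    obtain ⟨v, h0, hm, hv⟩ := ih r (left_ne_zero_of_mul hr)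
    refine ⟨Function.update v (m + 1) q, by simpa using h0, by simp, fun s hs => ?_⟩
    rw [Function.update_of_ne (by omega : s ≠ m + 1)]
    rcases Nat.lt_succ_iff_lt_or_eq.1 hs with hs | rfl
    · rw [Function.update_of_ne (by omega : s + 1 ≠ m + 1)]
      exact hv s hs
    · rw [Function.update_self, hm]
      exact right_ne_zero_of_mul hr

/-- The generating polynomial of the products of one matrix `F a` or `B a` for each `a` in `l`,
counted by the number of factors `F a`. -/
noncomputable def walkPoly {α n : Type*} [Fintype n] [DecidableEq n] (F B : α → Matrix n n ℕ)
    (l : List α) : (Matrix n n ℕ)[X] :=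
  (l.map fun a => C (F a) * X + C (B a)).prod

section walkPoly

variable {α n : Type*} [Fintype n] [DecidableEq n] (F B : α → Matrix n n ℕ)

theorem walkPoly_cons (a : α) (l : List α) :
    walkPoly F B (a :: l) = C (F a) * (X * walkPoly F B l) + C (B a) * walkPoly F B l := by
  simp [walkPoly, add_mul, mul_assoc]

theorem coeff_walkPoly_zero (l : List α) : (walkPoly F B l).coeff 0 = (l.map B).prod := by
  induction l with
  | nil => simp [walkPoly]
  | cons a l ih => simp [walkPoly_cons, ih]

theorem coeff_walkPoly_of_lt (l : List α) (j : ℕ) (hj : l.length < j) :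
    (walkPoly F B l).coeff j = 0 := by
  induction l generalizing j with
  | nil =>
    have : j ≠ 0 := by simp at hj; omega
    simp [walkPoly, coeff_one, this]
  | cons a l ih =>
    rw [List.length_cons] at hj
    obtain ⟨i, rfl⟩ : ∃ i, j = i + 1 := ⟨j - 1, by omega⟩
    rw [walkPoly_cons, coeff_add, coeff_C_mul, coeff_C_mul, coeff_X_mul, ih _ (by omega),
      ih _ (by omega), mul_zero, mul_zero, add_zero]

theorem coeff_walkPoly_length (l : List α) :
    (walkPoly F B l).coeff l.length = (l.map F).prod := by
  induction l with
  | nil => simp [walkPoly]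
  | cons a l ih =>
    rw [List.length_cons, walkPoly_cons, coeff_add, coeff_C_mul, coeff_C_mul, coeff_X_mul, ih,
      coeff_walkPoly_of_lt F B l _ (by omega)]
    simp

theorem coeff_walkPoly_support {R : Type*} [CommRing R] (d : n → R)
    (hF : ∀ a p q, F a p q ≠ 0 → d q = d p + 1) (hB : ∀ a p q, B a p q ≠ 0 → d p = d q + 1)
    (l : List α) (j : ℕ) (p q : n) (h : (walkPoly F B l).coeff j p q ≠ 0) :
    d q + l.length = d p + 2 * j := by
  induction l generalizing j p with
  | nil =>
    simp only [walkPoly, List.map_nil, List.prod_nil, coeff_one] at h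
    split_ifs at h with hj
    · have hpq : p = q := by
        by_contra hne
        exact h (Matrix.one_apply_ne hne)
      simp [hpq, hj]
    · simp at h
  | cons a l ih =>
    rw [walkPoly_cons, coeff_add, coeff_C_mul, coeff_C_mul, Matrix.add_apply] at h
    rw [List.length_cons, Nat.cast_add, Nat.cast_one]
    by_cases h₁ : (F a * (X * walkPoly F B l).coeff j) p q = 0
    · rw [h₁, zero_add, Matrix.mul_apply] at h
      obtain ⟨r, -, hr⟩ := Finset.exists_ne_zero_of_sum_ne_zero h
      linear_combination ih j r (right_ne_zero_of_mul hr) - hB a p r (left_ne_zero_of_mul hr)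
    · rw [Matrix.mul_apply] at h₁
      obtain ⟨r, -, hr⟩ := Finset.exists_ne_zero_of_sum_ne_zero h₁
      cases j with
      | zero => simp at hr
      | succ i =>
        rw [coeff_X_mul] at hr
        have := ih i r (right_ne_zero_of_mul hr)
        push_cast
        linear_combination this + hF a p r (left_ne_zero_of_mul hr)

theorem trace_prod_eq_sum_walkPoly (l : List α) {ω : ℂ} (hω : ω ≠ 0) :
    (l.map fun a => ω • (F a).map (Nat.cast : ℕ → ℂ) +
        ω⁻¹ • (B a).map (Nat.cast : ℕ → ℂ)).prod.trace =
      ∑ j ∈ Finset.range (l.length + 1),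
        (((walkPoly F B l).coeff j).trace : ℂ) * (ω ^ (2 * j) * ω⁻¹ ^ l.length) := by
  let φ : Matrix n n ℕ →+* Matrix n n ℂ := (Nat.castRingHom ℂ).mapMatrix
  have hφ (M : Matrix n n ℕ) : φ M = M.map (Nat.cast : ℕ → ℂ) := rfl
  let x : Matrix n n ℂ := Matrix.scalar n (ω ^ 2)
  have hx (M : Matrix n n ℕ) : Commute (φ M) x :=
    (Matrix.scalar_commute _ (fun r => Commute.all _ r) _).symm
  have hprod : (l.map fun a => ω • (F a).map (Nat.cast : ℕ → ℂ) +
      ω⁻¹ • (B a).map (Nat.cast : ℕ → ℂ)).prod =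
      ω⁻¹ ^ l.length • eval₂RingHom' φ x hx (walkPoly F B l) := by
    rw [walkPoly, map_list_prod, List.map_map]
    induction l with
    | nil => simp
    | cons a l ih =>
      have ha : ω • (F a).map (Nat.cast : ℕ → ℂ) + ω⁻¹ • (B a).map (Nat.cast : ℕ → ℂ) =
          ω⁻¹ • eval₂RingHom' φ x hx (C (F a) * X + C (B a)) := by
        have : x = ω ^ 2 • (1 : Matrix n n ℂ) := by
          simp [x, Matrix.smul_one_eq_diagonal]
        simp only [map_add, map_mul, eval₂RingHom'_apply, eval₂_C, eval₂_X, this, ← hφ]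
        rw [mul_smul_comm, mul_one, smul_add, smul_smul]
        congr 2
        field_simp
      rw [List.map_cons, List.prod_cons, ih, ha, List.map_cons, List.prod_cons, List.length_cons,
        smul_mul_smul_comm, pow_succ']
      rfl
  have hdeg : (walkPoly F B l).natDegree < l.length + 1 :=
    Nat.lt_succ_of_le (natDegree_le_iff_coeff_eq_zero.2 (coeff_walkPoly_of_lt F B l))
  rw [hprod, eval₂RingHom'_apply, eval₂_eq_sum_range' _ hdeg, Matrix.trace_smul,
    Matrix.trace_sum, Finset.smul_sum]
  refine Finset.sum_congr rfl fun j _ => ?_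
  have hxj : x ^ j = (ω ^ (2 * j)) • (1 : Matrix n n ℂ) := by
    rw [pow_mul, Matrix.smul_one_eq_diagonal, ← Matrix.scalar_apply, map_pow]
  rw [hxj, mul_smul_comm, mul_one, Matrix.trace_smul, hφ]
  have htr : (((walkPoly F B l).coeff j).map (Nat.cast : ℕ → ℂ)).trace =
      (((walkPoly F B l).coeff j).trace : ℂ) := by
    simp [Matrix.trace]
  rw [htr, smul_eq_mul, smul_eq_mul]
  ring

end walkPoly

/-! ### A non-real trace for words that are not self-adjoint -/

/-- The edges `p → p + 1` of the `k`-cycle for which the letter at position `p` is `(x, σ)`. -/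
def edgeMatrix {k ℓ : ℕ} (ι : Fin k → Fin ℓ) (τ : Fin k → Bool) (x : Fin ℓ) (σ : Bool) :
    Matrix (Fin k) (Fin k) ℕ :=
  Matrix.of fun p q =>
    if ((q : ℕ) : ZMod k) = ((p : ℕ) : ZMod k) + 1 ∧ ι p = x ∧ τ p = σ then 1 else 0

theorem edgeMatrix_ne_zero_iff {k ℓ : ℕ} (ι : Fin k → Fin ℓ) (τ : Fin k → Bool) (x : Fin ℓ)
    (σ : Bool) (p q : Fin k) : edgeMatrix ι τ x σ p q ≠ 0 ↔
      ((q : ℕ) : ZMod k) = ((p : ℕ) : ZMod k) + 1 ∧ ι p = x ∧ τ p = σ := by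
  simp [edgeMatrix]

/-- The assignment whose letters walk along the `k`-cycle, with weight `ω` on the steps in the
direction of the word and `ω̄` on the steps against it. -/
noncomputable def cycleAssignment {k ℓ : ℕ} (ι : Fin k → Fin ℓ) (τ : Fin k → Bool) (ω : ℂ)
    (x : Fin ℓ) : Matrix (Fin k) (Fin k) ℂ :=
  ω • (edgeMatrix ι τ x false).map (Nat.cast : ℕ → ℂ) +
    star ω • (edgeMatrix ι τ x true)ᵀ.map (Nat.cast : ℕ → ℂ)

theorem letter_cycleAssignment {k ℓ : ℕ} (hk : 0 < k) (ι : Fin k → Fin ℓ) (τ : Fin k → Bool)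
    (ω : ℂ) (s : ℕ) : letter hk ι τ (cycleAssignment ι τ ω) s =
      ω • (edgeMatrix ι τ (ι ⟨s % k, Nat.mod_lt _ hk⟩)
          (τ ⟨s % k, Nat.mod_lt _ hk⟩)).map (Nat.cast : ℕ → ℂ) +
        star ω • (edgeMatrix ι τ (ι ⟨s % k, Nat.mod_lt _ hk⟩)
          (!τ ⟨s % k, Nat.mod_lt _ hk⟩))ᵀ.map (Nat.cast : ℕ → ℂ) := by
  unfold letter cycleAssignment
  cases τ ⟨s % k, Nat.mod_lt _ hk⟩
  · simp
  · ext p q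
    simp [add_comm]

/-- A word that agrees with its adjoint up to a cyclic shift is self-adjoint. -/
theorem selfAdjointWord_of_reflection {k ℓ : ℕ} (hk : 0 < k) (ι : Fin k → Fin ℓ)
    (τ : Fin k → Bool) (p : Fin k)
    (h : ∀ i i' : Fin k, ((p : ℕ) : ZMod k) = (i : ℕ) + (i' : ℕ) + 1 →
      ι i = ι i' ∧ τ i ≠ τ i') : SelfAdjointWord hk ι τ := by
  have hp := p.isLt
  have hne (i : Fin k) : ((p : ℕ) : ZMod k) ≠ ((2 * i + 1 : ℕ) : ZMod k) := by
    intro hi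
    refine (h i i ?_).2 rfl
    rw [hi]
    push_cast
    ring
  have hp_even : (p : ℕ) % 2 = 0 := by
    by_contra hodd
    refine hne ⟨p / 2, by omega⟩ ?_
    congr 1
    dsimp only
    omega
  have heven : k % 2 = 0 := by
    by_contra heven
    refine hne ⟨(p + k) / 2, by omega⟩ ?_
    have : 2 * ((p + k) / 2) + 1 = (p : ℕ) + k := by omega
    simp [this]
  refine ⟨heven, (p + k) / 2 - 1, by omega, fun s hs => h _ _ ?_⟩
  have e : ((p + k) / 2 - 1 + 1 + s) + ((p + k) / 2 - 1 + k - s) + 1 = (p : ℕ) + k + k := by omega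
  have e' := congrArg (Nat.cast : ℕ → ZMod k) e
  simp only [ZMod.natCast_mod]
  push_cast at e' ⊢
  simpa using e'.symm

theorem trace_im_eq_zero {n : ℕ} {M : Matrix (Fin n) (Fin n) ℂ}
    (hM : ∀ μ : ℂ, M.charpoly.IsRoot μ → μ.im = 0) : M.trace.im = 0 := by
  rw [Matrix.trace_eq_sum_roots_charpoly]
  change Complex.imAddGroupHom _ = 0
  rw [map_multiset_sum]
  refine Multiset.sum_eq_zero fun y hy => ?_
  obtain ⟨μ, hμ, rfl⟩ := Multiset.mem_map.1 hy
  exact hM μ (isRoot_of_mem_roots hμ)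

theorem selfAdjointWord_of_realEigenvaluedC {k ℓ : ℕ} (hk : 0 < k) (ι : Fin k → Fin ℓ)
    (τ : Fin k → Bool) (hP : RealEigenvaluedC ι τ) : SelfAdjointWord hk ι τ := by
  let ω : ℂ := Complex.exp ((Real.pi / 2 / k : ℝ) * Complex.I)
  have hω : ω ≠ 0 := Complex.exp_ne_zero _
  have hωk : ω ^ k = Complex.I := by
    have : (k : ℂ) ≠ 0 := by exact_mod_cast hk.ne'
    have harg : (k : ℂ) * ((Real.pi / 2 / k : ℝ) * Complex.I) = Real.pi / 2 * Complex.I := by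
      push_cast
      field_simp
    rw [← Complex.exp_nat_mul, harg, Complex.exp_pi_div_two_mul_I]
  have hstar : star ω = ω⁻¹ := by
    rw [← Complex.exp_neg, Complex.star_def, ← Complex.exp_conj, map_mul, Complex.conj_ofReal,
      Complex.conj_I, mul_neg]
  let F : ℕ → Matrix (Fin k) (Fin k) ℕ := fun s =>
    edgeMatrix ι τ (ι ⟨s % k, Nat.mod_lt _ hk⟩) (τ ⟨s % k, Nat.mod_lt _ hk⟩)
  let B : ℕ → Matrix (Fin k) (Fin k) ℕ := fun s =>
    (edgeMatrix ι τ (ι ⟨s % k, Nat.mod_lt _ hk⟩) (!τ ⟨s % k, Nat.mod_lt _ hk⟩))ᵀ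
  by_contra hnot
  have hback : ((walkPoly F B (List.range k)).coeff 0).trace = 0 := by
    rw [coeff_walkPoly_zero]
    refine Finset.sum_eq_zero fun p _ => ?_
    by_contra hp
    obtain ⟨v, h0, -, hv⟩ := exists_walk_of_prod_range_apply_ne_zero B p p hp
    have hv' : ∀ s < k, _ := fun s hs => (edgeMatrix_ne_zero_iff _ _ _ _ _ _).1 (hv s hs)
    have hpos : ∀ s ≤ k, ((v s : ℕ) : ZMod k) = ((p : ℕ) : ZMod k) - s := by
      intro s
      induction s with
      | zero => simp [h0]
      | succ s ih =>
        intro hs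
        have h₁ := (hv' s (by omega)).1
        push_cast
        linear_combination ih (by omega) - h₁
    refine hnot (selfAdjointWord_of_reflection hk ι τ p fun i i' hi => ?_)
    have hvi : v (i + 1) = i' := by
      have h₁ := hpos (i + 1) i.isLt
      rw [hi] at h₁
      have h₂ : ((v (i + 1) : ℕ) : ZMod k) = ((i' : ℕ) : ZMod k) := by
        rw [h₁]; push_cast; ring
      rw [ZMod.natCast_eq_natCast_iff] at h₂
      exact Fin.ext (h₂.eq_of_lt_of_lt (v (i + 1)).isLt i'.isLt)
    obtain ⟨-, h₁, h₂⟩ := hv' i i.isLt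
    simp only [hvi, Nat.mod_eq_of_lt i.isLt, Fin.eta] at h₁ h₂
    simp [h₁, h₂]
  have hforw : 0 < ((walkPoly F B (List.range k)).coeff k).trace := by
    have hlen := coeff_walkPoly_length F B (List.range k)
    rw [List.length_range] at hlen
    rw [hlen]
    have := prod_range_apply_ne_zero (m := k) F (fun s => ⟨s % k, Nat.mod_lt _ hk⟩) fun s _ =>
      (edgeMatrix_ne_zero_iff _ _ _ _ _ _).2 ⟨by simp, rfl, rfl⟩
    simp only [Nat.mod_self, Nat.zero_mod] at this
    exact (Nat.pos_of_ne_zero this).trans_le (Finset.single_le_sum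
      (f := fun p => ((List.range k).map F).prod p p) (fun _ _ => Nat.zero_le _)
      (Finset.mem_univ _))
  have htrace := trace_im_eq_zero (hP k hk (cycleAssignment ι τ ω))
  have hletter : letter hk ι τ (cycleAssignment ι τ ω) = fun s =>
      ω • (F s).map (Nat.cast : ℕ → ℂ) + ω⁻¹ • (B s).map (Nat.cast : ℕ → ℂ) := by
    funext s
    rw [letter_cycleAssignment, hstar]
  rw [evalWordC_eq_prod_letter hk, hletter, trace_prod_eq_sum_walkPoly F B _ hω,
    Complex.im_sum, List.length_range] at htrace
  have hterm : ∀ j ∈ Finset.range (k + 1), j ≠ k →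
      ((((walkPoly F B (List.range k)).coeff j).trace : ℂ) * (ω ^ (2 * j) * ω⁻¹ ^ k)).im = 0 := by
    intro j hj hjk
    by_cases hc : ((walkPoly F B (List.range k)).coeff j).trace = 0
    · simp [hc]
    obtain ⟨p, -, hp⟩ := Finset.exists_ne_zero_of_sum_ne_zero hc
    have hsupp := coeff_walkPoly_support F B (fun p : Fin k => ((p : ℕ) : ZMod k))
      (fun a p q h => ((edgeMatrix_ne_zero_iff _ _ _ _ _ _).1 h).1)
      (fun a p q h => ((edgeMatrix_ne_zero_iff _ _ _ _ _ _).1 h).1) _ _ _ _ hp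
    have hdvd : k ∣ 2 * j := by
      rw [← ZMod.natCast_eq_zero_iff]
      push_cast
      simpa using hsupp.symm
    obtain ⟨c, hjc⟩ := hdvd
    have hj0 : j ≠ 0 := by
      rintro rfl
      exact hc hback
    have hjlt : j < k := by
      have := Finset.mem_range.1 hj
      omega
    have hc1 : c = 1 := by
      have h₁ : c ≠ 0 := by
        rintro rfl
        omega
      have h₂ : c < 2 := by
        by_contra hc2
        have := Nat.mul_le_mul_left k (not_lt.1 hc2)
        omega
      omega
    rw [hjc, hc1, mul_one, ← mul_pow, mul_inv_cancel₀ hω]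
    simp
  rw [Finset.sum_eq_single_of_mem k (by simp) hterm, two_mul, pow_add, mul_assoc, ← mul_pow,
    mul_inv_cancel₀ hω, hωk] at htrace
  simp at htrace
  omega

end RealEigenvaluedWord

/-- A symbolic complex matrix product is real-eigenvalued if and only if it is
self-adjoint. -/
theorem realEigenvaluedC_iff_selfAdjoint {k ℓ : ℕ} (hk : 0 < k)
    (ι : Fin k → Fin ℓ) (τ : Fin k → Bool) :
    RealEigenvaluedC ι τ ↔ SelfAdjointWord hk ι τ :=
  ⟨RealEigenvaluedWord.selfAdjointWord_of_realEigenvaluedC hk ι τ,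
    RealEigenvaluedWord.realEigenvaluedC_of_selfAdjointWord hk ι τ⟩
end

section
/- Let G be a finite simple graph and u, v vertices of G. If the walk-trees R_G(u) and R_G(v) are isomorphic as rooted trees, then there exists a bijection φ from the neighborhood of u to the neighborhood of v such that R_G(w) is isomorphic to R_G(φ(w)) for every neighbor w of u. -/
/-- In the walk-tree of `G` rooted at `r` (whose vertices are finite walks starting
at `r`), the walk `q` is a child of the walk `p` if `q` is obtained from `p` by
appending one edge. -/
def WalkChild {V : Type} (G : SimpleGraph V) {r : V}
    (p q : Σ x : V, G.Walk r x) : Prop :=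
  ∃ h : G.Adj p.1 q.1, q.2 = p.2.concat h

/-- The walk-trees `R_G(u)` and `R_G(v)` are isomorphic as rooted trees: there is a
bijection between their vertex sets (the finite walks from `u`, resp. from `v`)
mapping root to root and preserving the child relation. -/
def WalkTreeIso {V : Type} (G : SimpleGraph V) (u v : V) : Prop :=
  ∃ f : (Σ x : V, G.Walk u x) ≃ (Σ x : V, G.Walk v x),
    f ⟨u, SimpleGraph.Walk.nil⟩ = ⟨v, SimpleGraph.Walk.nil⟩ ∧
    ∀ p q : Σ x : V, G.Walk u x, WalkChild G p q ↔ WalkChild G (f p) (f q)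

namespace SimpleGraph.Walk

variable {V : Type} {G : SimpleGraph V}

/-- Prepending an edge, as a map from the walks starting at `w` to those starting at `u`. -/
def prepend {u w : V} (h : G.Adj u w) (p : Σ x : V, G.Walk w x) : Σ x : V, G.Walk u x :=
  ⟨p.1, cons h p.2⟩

theorem prepend_injective {u w : V} (h : G.Adj u w) : Function.Injective (prepend h) := by
  rintro ⟨x, p⟩ ⟨y, q⟩ e
  obtain ⟨rfl, e⟩ := Sigma.mk.inj_iff.1 e
  simpa using e

theorem walkChild_prepend {u w : V} (h : G.Adj u w) (p q : Σ x : V, G.Walk w x) :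
    WalkChild G (prepend h p) (prepend h q) ↔ WalkChild G p q := by
  simp [WalkChild, prepend, concat_cons]

theorem exists_prepend_of_walkChild {u w : V} (h : G.Adj u w) {p : Σ x : V, G.Walk w x}
    {q : Σ x : V, G.Walk u x} (hq : WalkChild G (prepend h p) q) :
    ∃ p', prepend h p' = q := by
  obtain ⟨x, q⟩ := q
  obtain ⟨h', e⟩ := hq
  exact ⟨⟨x, p.2.concat h'⟩, Sigma.ext rfl (heq_of_eq e.symm)⟩

theorem reflTransGen_walkChild_append {u x y : V} (p : G.Walk u x) (q : G.Walk x y) :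
    Relation.ReflTransGen (WalkChild G) (⟨x, p⟩ : Σ x : V, G.Walk u x) ⟨y, p.append q⟩ := by
  induction q with
  | nil => rw [append_nil]
  | cons h q ih =>
    rw [← concat_append]
    exact .head ⟨h, rfl⟩ (ih (p.concat h))

theorem reflTransGen_walkChild_prepend_iff {u w : V} (h : G.Adj u w)
    (q : Σ x : V, G.Walk u x) :
    Relation.ReflTransGen (WalkChild G) (prepend h ⟨w, nil⟩) q ↔ ∃ p, prepend h p = q := by
  constructor
  · intro hq
    induction hq with
    | refl => exact ⟨_, rfl⟩
    | tail _ hc ih =>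
      obtain ⟨p, rfl⟩ := ih
      exact exists_prepend_of_walkChild h hc
  · rintro ⟨p, rfl⟩
    exact reflTransGen_walkChild_append (cons h nil) p.2

/-- The walks starting at `w` correspond to the descendants of the one-edge walk from `u`
to `w`. -/
noncomputable def equivDescendants {u w : V} (h : G.Adj u w) :
    (Σ x : V, G.Walk w x) ≃
      {q : Σ x : V, G.Walk u x //
        Relation.ReflTransGen (WalkChild G) (prepend h ⟨w, nil⟩) q} :=
  Equiv.ofBijective
    (fun p => ⟨prepend h p, (reflTransGen_walkChild_prepend_iff h _).2 ⟨p, rfl⟩⟩)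
    ⟨fun _ _ e => prepend_injective h (Subtype.ext_iff.1 e), fun q =>
      ((reflTransGen_walkChild_prepend_iff h q.1).1 q.2).imp fun _ e => Subtype.ext e⟩

/-- The neighbors of `u` correspond to the children of the root of the walk-tree of `u`. -/
noncomputable def neighborEquivChildren (G : SimpleGraph V) (u : V) :
    G.neighborSet u ≃ {q : Σ x : V, G.Walk u x // WalkChild G ⟨u, nil⟩ q} :=
  Equiv.ofBijective (fun w => ⟨prepend w.2 ⟨w.1, nil⟩, w.2, rfl⟩)
    ⟨fun _ _ e => Subtype.ext (congrArg (fun q => q.1.1) e), by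
      rintro ⟨⟨x, q⟩, h, e⟩
      exact ⟨⟨x, h⟩, Subtype.ext (Sigma.ext rfl (heq_of_eq e.symm))⟩⟩

theorem walkTreeIso_of_relIso {u v w x : V} (h : G.Adj u w) (h' : G.Adj v x)
    (f : WalkChild G (r := u) ≃r WalkChild G (r := v))
    (hf : f (prepend h ⟨w, nil⟩) = prepend h' ⟨x, nil⟩) : WalkTreeIso G w x := by
  have hd : ∀ q, Relation.ReflTransGen (WalkChild G) (prepend h ⟨w, nil⟩) q ↔
      Relation.ReflTransGen (WalkChild G) (prepend h' ⟨x, nil⟩) (f q) := by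
    intro q
    rw [← hf]
    refine ⟨fun hq => hq.lift f fun _ _ => f.map_rel_iff.2, fun hq => ?_⟩
    simpa [Function.onFun] using hq.lift f.symm fun _ _ => f.symm.map_rel_iff.2
  let g := (equivDescendants h).trans
    ((f.toEquiv.subtypeEquiv hd).trans (equivDescendants h').symm)
  have hg : ∀ p, prepend h' (g p) = f (prepend h p) := fun p =>
    congrArg Subtype.val ((equivDescendants h').apply_symm_apply
      (f.toEquiv.subtypeEquiv hd (equivDescendants h p)))
  refine ⟨g, prepend_injective h' ((hg _).trans hf), fun p q => ?_⟩
  rw [← walkChild_prepend h', hg, hg, f.map_rel_iff, walkChild_prepend]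

end SimpleGraph.Walk

/-- If the walk-trees of `u` and `v` are isomorphic, then there is a bijection `φ`
between the neighborhoods of `u` and `v` such that `R_G(w) ≅ R_G(φ w)` for every
neighbor `w` of `u`. -/
theorem walkTreeIso_neighbor_bijection {V : Type} [Fintype V] (G : SimpleGraph V)
    (u v : V) (h : WalkTreeIso G u v) :
    ∃ φ : G.neighborSet u ≃ G.neighborSet v,
      ∀ w : G.neighborSet u, WalkTreeIso G w.1 (φ w).1 := by
  obtain ⟨f, hroot, hf⟩ := h
  have hc : ∀ q, WalkChild G ⟨u, .nil⟩ q ↔ WalkChild G ⟨v, .nil⟩ (f q) := fun q => by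
    rw [hf, hroot]
  let e := f.subtypeEquiv hc
  let E := SimpleGraph.Walk.neighborEquivChildren G
  refine ⟨(E u).trans (e.trans (E v).symm), fun w => ?_⟩
  refine SimpleGraph.Walk.walkTreeIso_of_relIso w.2 (Subtype.prop _) ⟨f, (hf _ _).symm⟩ ?_
  exact (congrArg Subtype.val ((E v).apply_symm_apply (e (E u w)))).symm
end
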